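/- Let G₀ be the group whose underlying set is {0,1,2,3} × {0,1} × {0,1} with multiplication (k,l,m)·(k',l',m') = ((k + (-1)^l k') mod 4, (l+l') mod 2, (m+m') mod 2) (the standard-form model of D₄ × ℤ/2). Then the function η : G₀ × G₀ → ℂˣ defined by η((k,l,m),(k',l',m')) = i^{l(k' + 2m')} (where i = √-1) satisfies the 2-cocycle identity: η(g,h)·η(g·h, k) = η(h,k)·η(g, h·k) for all g, h, k ∈ G₀. -/

import Mathlib

/-- The imaginary unit i = √-1 as a unit of ℂ. -/
noncomputable def iu : ℂˣ := Units.mk0 Complex.I Complex.I_ne_zero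

/-- The standard-form model of D₄ × ℤ/2: ⟨k, l, m⟩ corresponds to x^k y^l z^m,
with k ∈ {0,1,2,3} and l, m ∈ {0,1}. -/
@[ext]
structure G0 where
  k : ZMod 4
  l : ZMod 2
  m : ZMod 2
deriving DecidableEq, Fintype

namespace G0

/-- (k,l,m)·(k',l',m') = ((k + (-1)^l k') mod 4, (l+l') mod 2, (m+m') mod 2). -/
protected def mul (g h : G0) : G0 :=
  ⟨g.k + (if g.l = 0 then h.k else -h.k), g.l + h.l, g.m + h.m⟩

protected def inv (g : G0) : G0 := ⟨if g.l = 0 then -g.k else g.k, g.l, g.m⟩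

private lemma two_cases : ∀ a : ZMod 2, a = 0 ∨ a = 1 := by decide
private lemma self_add_self : ∀ a : ZMod 2, a + a = 0 := by decide
private lemma two_eq_zero : (2 : ZMod 2) = 0 := by decide
private lemma one_ne_zero' : (1 : ZMod 2) ≠ 0 := by decide

protected theorem mul_assoc (g h j : G0) :
    (g.mul h).mul j = g.mul (h.mul j) := by
  obtain ⟨k, l, m⟩ := g; obtain ⟨k', l', m'⟩ := h; obtain ⟨k'', l'', m''⟩ := j
  rcases two_cases l with rfl | rfl <;> rcases two_cases l' with rfl | rfl <;>
    simp [G0.mul, add_assoc, two_eq_zero, one_ne_zero'] <;> ring_nf <;>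
    simp [two_eq_zero] <;> ring_nf

protected theorem one_mul (g : G0) : G0.mul ⟨0, 0, 0⟩ g = g := by
  simp [G0.mul]

protected theorem mul_one (g : G0) : G0.mul g ⟨0, 0, 0⟩ = g := by
  rcases two_cases g.l with h | h <;> ext <;> simp [G0.mul, h]

protected theorem inv_mul_cancel (g : G0) : (g.inv).mul g = ⟨0, 0, 0⟩ := by
  rcases two_cases g.l with h | h <;> ext <;>
    simp [G0.mul, G0.inv, h, self_add_self, one_ne_zero']

instance : Group G0 where
  mul := G0.mul
  one := ⟨0, 0, 0⟩
  inv := G0.inv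
  mul_assoc := G0.mul_assoc
  one_mul := G0.one_mul
  mul_one := G0.mul_one
  inv_mul_cancel := G0.inv_mul_cancel

end G0

theorem iu_pow_four : iu ^ 4 = 1 := by
  ext
  simp [iu]

theorem iu_pow_eq_of_cast_eq {a b : ℕ} (hab : (a : ZMod 4) = b) : iu ^ a = iu ^ b :=
  pow_eq_pow_of_modEq ((ZMod.natCast_eq_natCast_iff a b 4).1 hab) iu_pow_four

/-- Doubling descends to an additive map from ℤ/2 to ℤ/4. -/
theorem two_mul_val_add_cast : ∀ a b : ZMod 2,
    (2 * ((a + b).val : ZMod 4)) = 2 * (a.val : ZMod 4) + 2 * (b.val : ZMod 4) := by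
  decide

theorem four_mul_eq_zero : ∀ a : ZMod 4, 4 * a = 0 := by decide

namespace G0

theorem mul_k (g h : G0) : (g * h).k = g.k + (if g.l = 0 then h.k else -h.k) := rfl

theorem mul_l (g h : G0) : (g * h).l = g.l + h.l := rfl

theorem mul_m (g h : G0) : (g * h).m = g.m + h.m := rfl

end G0

/-- The obstruction cocycle η((k,l,m),(k',l',m')) = i^{l(k'+2m')} of the divisor A₂
on the curve C₂ (case G = D₄ × ℤ/2) satisfies the 2-cocycle identity. -/
theorem eta_A2_is_two_cocycle :
    ∀ g h j : G0,
      (iu ^ (g.l.val * (h.k.val + 2 * h.m.val))) *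
          (iu ^ ((g * h).l.val * (j.k.val + 2 * j.m.val))) =
        (iu ^ (h.l.val * (j.k.val + 2 * j.m.val))) *
          (iu ^ (g.l.val * ((h * j).k.val + 2 * (h * j).m.val))) := by
  intro g h j
  rw [← pow_add, ← pow_add]
  apply iu_pow_eq_of_cast_eq
  push_cast
  rw [G0.mul_k, G0.mul_l, G0.mul_m, two_mul_val_add_cast]
  simp only [ZMod.natCast_zmod_val]
  have val_zero : (0 : ZMod 2).val = 0 := rfl
  have val_one : (1 : ZMod 2).val = 1 := rfl
  have one_add_one : (1 + 1 : ZMod 2) = 0 := rfl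
  rcases G0.two_cases g.l with hg | hg <;> rcases G0.two_cases h.l with hh | hh <;>
    simp only [hg, hh, val_zero, val_one, one_add_one, add_zero, zero_add, one_ne_zero,
      if_true, if_false, Nat.cast_zero, Nat.cast_one]
  · ring
  · ring
  · ring
  · linear_combination -four_mul_eq_zero (j.m.val : ZMod 4)
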